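/- Let D ∈ CD_{n,k} be a chord diagram and let C and C′ be domino matrices of D, both satisfying the sign rules. If the row spaces of C and C′ in ℝ^n coincide, then there exist positive real numbers λ_1, …, λ_k such that C′_l = λ_l·C_l for every l = 1, …, k (the domino representative of a point of the BCFW cell is unique up to rescaling each row by a positive number). -/

import Mathlib

open scoped Classical

noncomputable section

/-- A rectangular `n × r` matrix (with `r ≤ n`) is *positive* if all of its maximal
`r × r` minors (rows selected in increasing order) have positive determinant. -/
def IsPositiveMatrix {n r : ℕ} (Z : Matrix (Fin n) (Fin r) ℝ) : Prop :=
  ∀ f : Fin r → Fin n, StrictMono f → 0 < (Z.submatrix f id).det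

/-- A `k × n` matrix is *totally nonnegative* if all of its `k × k` minors
(columns selected in increasing order) have nonnegative determinant. -/
def IsTotallyNonnegRect {k n : ℕ} (C : Matrix (Fin k) (Fin n) ℝ) : Prop :=
  ∀ g : Fin k → Fin n, StrictMono g → 0 ≤ (C.submatrix id g).det

/-- The row of `Z` whose (1-based) marker is `p`, i.e. the row with index `p - 1`. -/
def markerRow {n r : ℕ} (Z : Matrix (Fin n) (Fin r) ℝ) (p : ℕ) : Fin r → ℝ :=
  if h : p - 1 < n then Z ⟨p - 1, h⟩ else 0

/-- The twistor coordinate `⟨Y a₁ a₂ a₃ a₄⟩`: the determinant of the `(k+4) × (k+4)` matrix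
whose rows are the `k` rows of `Y` followed by the rows of `Z` with (1-based) markers
`a 0, a 1, a 2, a 3`. -/
def twistor {n k : ℕ} (Z : Matrix (Fin n) (Fin (k + 4)) ℝ)
    (Y : Matrix (Fin k) (Fin (k + 4)) ℝ) (a : Fin 4 → ℕ) : ℝ :=
  ((Matrix.fromRows Y (Matrix.of fun t => markerRow Z (a t))).submatrix
    (⇑finSumFinEquiv.symm) id).det

/-- The row space of a matrix: the span of its rows. -/
def rowSpace {k n : ℕ} (A : Matrix (Fin k) (Fin n) ℝ) : Submodule ℝ (Fin n → ℝ) :=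
  Submodule.span ℝ (Set.range fun r => A r)

/-- The minor of `A` on the set of rows `S` (taken in increasing order), using all columns;
defined to be `0` if `S` does not have the right cardinality. -/
def rowMinor {N r : ℕ} (A : Matrix (Fin N) (Fin r) ℝ) (S : Finset (Fin N)) : ℝ :=
  if h : S.card = r then (A.submatrix (fun t => (S.orderIsoOfFin h t).1) id).det else 0

/-- The minor of `C` on the set of columns `J` (taken in increasing order), using all rows;
defined to be `0` if `J` does not have the right cardinality. -/
def colMinor {k N : ℕ} (C : Matrix (Fin k) (Fin N) ℝ) (J : Finset (Fin N)) : ℝ :=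
  if h : J.card = k then (C.submatrix id (fun t => (J.orderIsoOfFin h t).1)).det else 0


/-- A chord diagram with `n` markers (labelled `1, …, n`) and `k` chords
`c_l = (tail l, tail l + 1, head l, head l + 1)`. -/
structure ChordDiagram (n k : ℕ) where
  tail : Fin k → ℕ
  head : Fin k → ℕ
  one_le_tail : ∀ l, 1 ≤ tail l
  tail_add_two_le_head : ∀ l, tail l + 2 ≤ head l
  head_add_two_le : ∀ l, head l + 2 ≤ n
  tail_strictMono : StrictMono tail
  noncrossing : ∀ l m : Fin k, l < m → ¬(tail m < head l ∧ head l < head m)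

namespace ChordDiagram

variable {n k : ℕ} (D : ChordDiagram n k)

/-- `c_m` is a descendant of `c_l`. -/
def Descendant (l m : Fin k) : Prop := D.tail l < D.tail m ∧ D.head m ≤ D.head l

/-- The number of descendants of `c_l`. -/
def below (l : Fin k) : ℕ := (Finset.univ.filter fun m => D.Descendant l m).card

/-- `c_l` is a top chord: it has no ancestor. -/
def IsTop (l : Fin k) : Prop := ∀ m, ¬ D.Descendant m l

/-- `c_m` is the parent of `c_l`: the ancestor of `c_l` with the largest start. -/
def IsParent (m l : Fin k) : Prop :=
  D.Descendant m l ∧ ∀ m', D.Descendant m' l → D.tail m' ≤ D.tail m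

/-- The number of chords starting after the start of `c_l` (equals `k - l` for the
`l`-th chord in the 1-based start-increasing ordering). -/
def behind (l : Fin k) : ℕ := (Finset.univ.filter fun m => D.tail l < D.tail m).card

/-- The number of descendants of `c_m` (the parent of `c_l`) that come before `c_l`
(equals `l - m - 1` in the 1-based start-increasing ordering). -/
def beyond (l m : Fin k) : ℕ :=
  (Finset.univ.filter fun h => D.Descendant m h ∧ D.tail h < D.tail l).card

/-- The domino matrix of `D` with variables `α, β, γ, δ, ε` : the column with (0-based)
index `a` corresponds to the (1-based) marker `a + 1`. -/
def dominoMatrix (α β γ δ ε : Fin k → ℝ) : Matrix (Fin k) (Fin n) ℝ :=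
  Matrix.of fun l a =>
    (if (a : ℕ) + 1 = D.tail l then α l else 0) +
    (if (a : ℕ) + 1 = D.tail l + 1 then β l else 0) +
    (if (a : ℕ) + 1 = D.head l then γ l else 0) +
    (if (a : ℕ) + 1 = D.head l + 1 then δ l else 0) +
    (if D.IsTop l ∧ (a : ℕ) + 1 = n then ε l else 0) +
    (∑ m : Fin k, if D.IsParent m l then
        (if (a : ℕ) + 1 = D.tail m then ε l * α m else 0) +
        (if (a : ℕ) + 1 = D.tail m + 1 then ε l * β m else 0)
      else 0)

/-- The sign rules for the domino variables of `D`. -/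
def SignRules (α β γ δ ε : Fin k → ℝ) : Prop :=
  (∀ l, 0 < α l) ∧ (∀ l, 0 < β l) ∧
  (∀ l, 0 < (-1 : ℝ) ^ D.below l * γ l) ∧
  (∀ l, 0 < (-1 : ℝ) ^ D.below l * δ l) ∧
  (∀ l, D.IsTop l → 0 < (-1 : ℝ) ^ D.behind l * ε l) ∧
  (∀ l m, D.IsParent m l → 0 < (-1 : ℝ) ^ D.beyond l m * ε l) ∧
  (∀ l m, D.IsParent m l → D.head l = D.head m → δ l / γ l < δ m / γ m) ∧
  (∀ l m, D.head m = D.tail l → δ m / γ m < β l / α l)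

end ChordDiagram


namespace ChordDiagram

variable {n k : ℕ} (D : ChordDiagram n k)

/-- The total coefficient of the tail domino of `x` in the combination `∑ m, t m • C m`. -/
def tailCoeff (ε t : Fin k → ℝ) (x : Fin k) : ℝ :=
  t x + ∑ y, if D.IsParent x y then ε y * t y else 0

/-- The sum of `w` over the chords whose tail is at marker `c`. -/
def tailSum (w : Fin k → ℝ) (c : ℕ) : ℝ := ∑ x, if D.tail x = c then w x else 0

/-- The sum of `w` over the chords whose head is at marker `c`. -/
def headSum (w : Fin k → ℝ) (c : ℕ) : ℝ := ∑ x, if D.head x = c then w x else 0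

/-- The entry of `∑ m, t m • C m` at marker `c + 1`, apart from the contribution of the top
chords at the last marker. -/
def entry (α β γ δ ε t : Fin k → ℝ) (c : ℕ) : ℝ :=
  D.tailSum (fun x => D.tailCoeff ε t x * α x) (c + 1) +
    D.tailSum (fun x => D.tailCoeff ε t x * β x) c +
    D.headSum (fun x => t x * γ x) (c + 1) + D.headSum (fun x => t x * δ x) c

/-- The tail coefficient of `x`, corrected by the children of `x` whose head is at most `c`. -/
def openCoeff (ε t : Fin k → ℝ) (x : Fin k) (c : ℕ) : ℝ :=
  D.tailCoeff ε t x - ∑ y, if D.IsParent x y ∧ D.head y ≤ c then ε y * t y else 0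

/-- The number of descendants of `x` whose tail is before `c`. -/
def started (x : Fin k) (c : ℕ) : ℕ :=
  (Finset.univ.filter fun h => D.Descendant x h ∧ D.tail h < c).card

/-- The number of chords whose tail is in `[c, c')`. -/
def startedIn (c c' : ℕ) : ℕ :=
  (Finset.univ.filter fun h => c ≤ D.tail h ∧ D.tail h < c').card

variable {D} {α β γ δ ε t : Fin k → ℝ}

lemma eq_of_tail_eq {x y : Fin k} (h : D.tail x = D.tail y) : x = y :=
  D.tail_strictMono.injective h

lemma head_le_of_tail_lt {x y : Fin k} (h : D.tail x < D.tail y) (h' : D.tail y < D.head x) :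
    D.head y ≤ D.head x :=
  not_lt.1 fun hc => D.noncrossing x y (D.tail_strictMono.lt_iff_lt.1 h) ⟨h', hc⟩

lemma IsParent.unique {x x' y : Fin k} (h : D.IsParent x y) (h' : D.IsParent x' y) : x = x' :=
  eq_of_tail_eq (le_antisymm (h'.2 _ h.1) (h.2 _ h'.1))

lemma exists_isParent {x y : Fin k} (h : D.Descendant x y) : ∃ p, D.IsParent p y := by
  obtain ⟨p, hp, hmax⟩ := Finset.exists_max_image (Finset.univ.filter fun m => D.Descendant m y)
    D.tail ⟨x, by simpa using h⟩
  exact ⟨p, by simpa using hp, fun m hm => hmax m (by simpa using hm)⟩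

lemma tailSum_eq {w : Fin k → ℝ} (x : Fin k) : D.tailSum w (D.tail x) = w x := by
  unfold tailSum
  rw [Finset.sum_eq_single x]
  · simp
  · intro y _ hy
    exact if_neg fun h => hy (eq_of_tail_eq h)
  · simp

lemma tailSum_eq_zero {w : Fin k → ℝ} {c : ℕ} (h : ∀ x, D.tail x = c → w x = 0) :
    D.tailSum w c = 0 :=
  Finset.sum_eq_zero fun x _ => by
    split_ifs with hx
    exacts [h x hx, rfl]

lemma headSum_eq_zero {w : Fin k → ℝ} {c : ℕ} (h : ∀ x, D.head x = c → w x = 0) :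
    D.headSum w c = 0 :=
  Finset.sum_eq_zero fun x _ => by
    split_ifs with hx
    exacts [h x hx, rfl]

lemma coeff_eq_sub (x : Fin k) :
    t x = D.tailCoeff ε t x - ∑ y, if D.IsParent x y then ε y * t y else 0 := by
  simp [tailCoeff]

lemma coeff_eq_openCoeff_sub (x : Fin k) (c : ℕ) :
    t x = D.openCoeff ε t x c -
      ∑ y, if D.IsParent x y ∧ c < D.head y then ε y * t y else 0 := by
  rw [openCoeff, sub_sub, ← Finset.sum_add_distrib, coeff_eq_sub (D := D) (ε := ε) (t := t) x]
  congr 1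
  refine Finset.sum_congr rfl fun y _ => ?_
  by_cases h : D.IsParent x y <;> by_cases h' : D.head y ≤ c <;> simp [h, h', not_lt.2, not_le.1]

lemma openCoeff_eq_openCoeff_sub (x : Fin k) {c c' : ℕ} (hc : c ≤ c') :
    D.openCoeff ε t x c' = D.openCoeff ε t x c -
      ∑ y, if D.IsParent x y ∧ c < D.head y ∧ D.head y ≤ c' then ε y * t y else 0 := by
  rw [openCoeff, openCoeff, sub_sub, ← Finset.sum_add_distrib]
  congr 1
  refine Finset.sum_congr rfl fun y _ => ?_
  by_cases h : D.IsParent x y <;> by_cases h' : D.head y ≤ c <;> by_cases h'' : D.head y ≤ c' <;>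
    simp [h, h', h'', not_lt.2, not_le.1]; omega

lemma openCoeff_eq_coeff {x : Fin k} {c : ℕ} (h : D.head x ≤ c) : D.openCoeff ε t x c = t x := by
  rw [coeff_eq_openCoeff_sub (D := D) (ε := ε) (t := t) x c, eq_comm, sub_eq_self]
  refine Finset.sum_eq_zero fun y _ => if_neg ?_
  rintro ⟨⟨hd, -⟩, hy⟩
  have := hd.2
  omega

lemma coeff_eq_tailCoeff {x : Fin k} (h : ∀ y, D.IsParent x y → t y = 0) :
    t x = D.tailCoeff ε t x := by
  rw [tailCoeff, eq_comm, add_eq_left]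
  exact Finset.sum_eq_zero fun y _ => by
    split_ifs with hy
    exacts [by rw [h y hy, mul_zero], rfl]

lemma coeff_eq_zero_of_tailCoeff (x : Fin k) (hx : D.tailCoeff ε t x = 0)
    (h : ∀ y, D.Descendant x y → D.tailCoeff ε t y = 0) : t x = 0 := by
  induction hm : n - D.tail x using Nat.strong_induction_on generalizing x with
  | _ m ih =>
    refine (coeff_eq_tailCoeff fun y hy => ?_).trans hx
    have h1 := hy.1.1
    have h2 := D.tail_add_two_le_head y
    have h3 := D.head_add_two_le y
    exact ih (n - D.tail y) (by omega) y (h y hy.1)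
      (fun z hz => h z ⟨h1.trans hz.1, hz.2.trans hy.1.2⟩) rfl

lemma tailCoeff_mul_add_headSum_eq_zero (y : Fin k)
    (hZ : ∀ c, D.tail y ≤ c → c + 1 < D.head y → D.entry α β γ δ ε t c = 0)
    (hβ : ∀ l, 0 < β l) :
    D.tailCoeff ε t y * β y + D.headSum (fun x => t x * δ x) (D.tail y) = 0 := by
  induction hm : n - D.tail y using Nat.strong_induction_on generalizing y with
  | _ m ih =>
    have hy2 := D.tail_add_two_le_head y
    have hyn := D.head_add_two_le y
    have nohead : ∀ x, D.head x ≠ D.tail y + 1 := fun x hx => by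
      have := D.tail_add_two_le_head x
      have := head_le_of_tail_lt (D := D) (x := x) (y := y) (by omega) (by omega)
      omega
    have h0 := hZ (D.tail y) le_rfl (by omega)
    rw [entry, tailSum_eq, headSum_eq_zero (c := D.tail y + 1) fun x hx => (nohead x hx).elim] at h0
    have h1 : D.tailSum (fun x => D.tailCoeff ε t x * α x) (D.tail y + 1) = 0 := by
      refine tailSum_eq_zero fun u hu => ?_
      have hh := head_le_of_tail_lt (D := D) (x := y) (y := u) (by omega) (by omega)
      have := ih (n - D.tail u) (by omega) u (fun c hc hc' => hZ c (by omega) (by omega)) rfl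
      rw [hu, headSum_eq_zero (c := D.tail y + 1) fun x hx => (nohead x hx).elim] at this
      have := (mul_eq_zero.1 (by simpa using this)).resolve_right (hβ u).ne'
      rw [this, zero_mul]
    linarith

lemma tailCoeff_descendant_eq_zero (hβ : ∀ l, 0 < β l) (x : Fin k)
    (hZ : ∀ c, D.tail x + 1 ≤ c → c + 1 < D.head x → D.entry α β γ δ ε t c = 0)
    (y : Fin k) (hy : D.Descendant x y) : D.tailCoeff ε t y = 0 := by
  induction hm : D.tail y using Nat.strong_induction_on generalizing y with
  | _ m ih =>
    obtain ⟨h1, h2⟩ := hy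
    have hy2 := D.tail_add_two_le_head y
    have := tailCoeff_mul_add_headSum_eq_zero y
      (fun c hc hc' => hZ c (by omega) (by omega)) hβ
    rw [headSum_eq_zero] at this
    · exact (mul_eq_zero.1 (by simpa using this)).resolve_right (hβ y).ne'
    · intro u hu
      have hu2 := D.tail_add_two_le_head u
      have hux : D.tail x < D.tail u := by
        by_contra hc
        rcases (not_lt.1 hc).lt_or_eq with hc | hc
        · have := head_le_of_tail_lt hc (by omega)
          omega
        · rw [eq_of_tail_eq hc] at hu
          omega
      rw [coeff_eq_zero_of_tailCoeff (ε := ε) (D := D) u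
        (ih _ (by omega) u ⟨hux, by omega⟩ rfl), zero_mul]
      rintro v ⟨hv1, hv2⟩
      have hv3 := D.tail_add_two_le_head v
      exact ih _ (by omega) v ⟨by omega, by omega⟩ rfl

lemma coeff_descendant_eq_zero (hβ : ∀ l, 0 < β l) (x : Fin k)
    (hZ : ∀ c, D.tail x + 1 ≤ c → c + 1 < D.head x → D.entry α β γ δ ε t c = 0)
    (y : Fin k) (hy : D.Descendant x y) : t y = 0 :=
  coeff_eq_zero_of_tailCoeff y (tailCoeff_descendant_eq_zero hβ x hZ y hy) fun z hz =>
    tailCoeff_descendant_eq_zero hβ x hZ z ⟨hy.1.trans hz.1, hz.2.trans hy.2⟩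

lemma coeff_eq_tailCoeff_of_entry (hβ : ∀ l, 0 < β l) (x : Fin k)
    (hZ : ∀ c, D.tail x + 1 ≤ c → c + 1 < D.head x → D.entry α β γ δ ε t c = 0) :
    t x = D.tailCoeff ε t x :=
  coeff_eq_tailCoeff fun y hy => coeff_descendant_eq_zero hβ x hZ y hy.1

/-! ### Counting descendants -/

lemma started_eq_below {x : Fin k} {c : ℕ} (h : D.head x ≤ c) : D.started x c = D.below x := by
  unfold started below
  congr 1
  refine Finset.filter_congr fun u _ => and_iff_left_of_imp fun hu => ?_
  have := D.tail_add_two_le_head u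
  have := hu.2
  omega

lemma started_eq_add_one_add {x y : Fin k} {c : ℕ} (h : D.Descendant x y) (hc : D.tail y < c)
    (hc' : c ≤ D.head y) : D.started x c = D.started x (D.tail y) + 1 + D.started y c := by
  unfold started
  have : (Finset.univ.filter fun u => D.Descendant x u ∧ D.tail u < c) =
      insert y (Finset.univ.filter fun u => D.Descendant x u ∧ D.tail u < D.tail y) ∪
        Finset.univ.filter fun u => D.Descendant y u ∧ D.tail u < c := by
    ext u
    simp only [Finset.mem_filter, Finset.mem_univ, true_and, Finset.mem_union, Finset.mem_insert]
    constructor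
    · rintro ⟨h1, h2⟩
      rcases lt_trichotomy (D.tail u) (D.tail y) with h3 | h3 | h3
      · exact Or.inl (Or.inr ⟨h1, h3⟩)
      · exact Or.inl (Or.inl (eq_of_tail_eq h3))
      · exact Or.inr ⟨⟨h3, head_le_of_tail_lt h3 (by omega)⟩, h2⟩
    · rintro ((rfl | ⟨h1, h2⟩) | ⟨h1, h2⟩)
      · exact ⟨h, hc⟩
      · exact ⟨h1, h2.trans hc⟩
      · exact ⟨⟨h.1.trans h1.1, h1.2.trans h.2⟩, h2⟩
  rw [this, Finset.card_union_of_disjoint, Finset.card_insert_of_notMem]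
  · simp
  · rw [Finset.disjoint_left]
    intro u hu hu'
    simp only [Finset.mem_filter, Finset.mem_univ, true_and, Finset.mem_insert] at hu hu'
    have := hu'.1.1
    rcases hu with rfl | hu
    · omega
    · omega

lemma started_eq_add_startedIn {x : Fin k} {c c' : ℕ} (hx : D.tail x < c) (hc : c ≤ c')
    (hc' : c' ≤ D.head x) : D.started x c' = D.started x c + D.startedIn c c' := by
  unfold started startedIn
  rw [← Finset.card_union_of_disjoint]
  · congr 1
    ext u
    simp only [Finset.mem_filter, Finset.mem_univ, true_and, Finset.mem_union]
    constructor
    · rintro ⟨h1, h2⟩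
      by_cases h3 : D.tail u < c
      exacts [Or.inl ⟨h1, h3⟩, Or.inr ⟨not_lt.1 h3, h2⟩]
    · rintro (⟨h1, h2⟩ | ⟨h1, h2⟩)
      · exact ⟨h1, by omega⟩
      · exact ⟨⟨by omega, head_le_of_tail_lt (by omega) (by omega)⟩, h2⟩
  · rw [Finset.disjoint_left]
    intro u hu hu'
    simp only [Finset.mem_filter, Finset.mem_univ, true_and] at hu hu'
    omega

lemma startedIn_tail {z : Fin k} {c : ℕ} (hz : D.tail z < c) (hc : c ≤ D.head z) :
    D.startedIn (D.tail z) c = 1 + D.started z c := by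
  unfold started startedIn
  have : (Finset.univ.filter fun u => D.tail z ≤ D.tail u ∧ D.tail u < c) =
      insert z (Finset.univ.filter fun u => D.Descendant z u ∧ D.tail u < c) := by
    ext u
    simp only [Finset.mem_filter, Finset.mem_univ, true_and, Finset.mem_insert]
    constructor
    · rintro ⟨h1, h2⟩
      rcases h1.eq_or_lt with h1 | h1
      · exact Or.inl (eq_of_tail_eq h1).symm
      · exact Or.inr ⟨⟨h1, head_le_of_tail_lt h1 (by omega)⟩, h2⟩
    · rintro (rfl | ⟨h1, h2⟩)
      · exact ⟨le_rfl, hz⟩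
      · exact ⟨h1.1.le, h2⟩
  rw [this, Finset.card_insert_of_notMem, add_comm]
  simp only [Finset.mem_filter, Finset.mem_univ, true_and]
  exact fun h => h.1.1.false

lemma startedIn_eq_zero {c : ℕ} (h : ∀ z, D.tail z ≠ c) : D.startedIn c (c + 1) = 0 := by
  rw [startedIn, Finset.card_eq_zero, Finset.filter_eq_empty_iff]
  intro u _ hu
  exact h u (by omega)

lemma neg_one_pow_sq (m : ℕ) : ((-1 : ℝ) ^ m) * (-1) ^ m = 1 := by
  rw [← mul_pow]
  simp

lemma started_mul_child {x y : Fin k} {c : ℕ} (h : D.Descendant x y) (hc : D.tail y < c)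
    (hc' : c ≤ D.head y) (s : ℝ) :
    (-1 : ℝ) ^ D.started x c * (ε y * s) =
      -(((-1) ^ D.beyond y x * ε y) * ((-1) ^ D.started y c * s)) := by
  rw [started_eq_add_one_add h hc hc', pow_add, pow_succ]
  change _ = -(((-1) ^ D.started x (D.tail y) * ε y) * ((-1) ^ D.started y c * s))
  ring

/-! ### Propagation of signs -/

lemma child_sum_nonneg (hs : D.SignRules α β γ δ ε) (x : Fin k) (c : ℕ) (e : ℝ)
    (p : Fin k → Prop) [DecidablePred p]
    (h : ∀ y, D.IsParent x y → p y → t y ≠ 0 → D.tail y < c ∧ c ≤ D.head y ∧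
      0 ≤ e * ((-1) ^ D.started y c * t y)) :
    0 ≤ -(e * ((-1) ^ D.started x c *
      ∑ y, if D.IsParent x y ∧ p y then ε y * t y else 0)) := by
  rw [Finset.mul_sum, Finset.mul_sum, ← Finset.sum_neg_distrib]
  refine Finset.sum_nonneg fun y _ => ?_
  split_ifs with hy
  · by_cases ht : t y = 0
    · simp [ht]
    · obtain ⟨h1, h2, h3⟩ := h y hy.1 hy.2 ht
      rw [started_mul_child hy.1.1 h1 h2]
      have := mul_nonneg (hs.2.2.2.2.2.1 y x hy.1).le h3
      linarith
  · simp

lemma mul_nonneg_of_sign {e s w : ℝ} {b : ℕ} (h : 0 ≤ e * ((-1) ^ b * s))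
    (hw : 0 < (-1) ^ b * w) : 0 ≤ e * (s * w) := by
  have := mul_nonneg h hw.le
  have h1 := neg_one_pow_sq b
  calc 0 ≤ e * ((-1) ^ b * s) * ((-1) ^ b * w) := this
    _ = e * (s * w) * ((-1) ^ b * (-1) ^ b) := by ring
    _ = e * (s * w) := by rw [h1, mul_one]

lemma eq_zero_of_sign {e s w : ℝ} {b : ℕ} (he : e ≠ 0) (hw : 0 < (-1 : ℝ) ^ b * w)
    (h : e * (s * w) = 0) : s = 0 := by
  have hw' : w ≠ 0 := by
    rintro rfl
    simp at hw
  simpa [he, hw'] using h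

lemma eq_zero_of_headSum_add_eq_zero {f : Fin k → ℝ} {c : ℕ} {κ : ℝ}
    (hf : ∀ x, D.head x = c → 0 ≤ f x) (hκ : 0 ≤ κ) (h : D.headSum f c + κ = 0) (x : Fin k)
    (hx : D.head x = c) : f x = 0 := by
  have hnn : ∀ y ∈ Finset.univ, 0 ≤ if D.head y = c then f y else 0 := fun y _ => by
    split_ifs with hy
    exacts [hf y hy, le_rfl]
  have h0 : D.headSum f c = 0 := by
    have : 0 ≤ D.headSum f c := Finset.sum_nonneg hnn
    linarith
  have := (Finset.sum_eq_zero_iff_of_nonneg hnn).1 h0 x (Finset.mem_univ x)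
  rwa [if_pos hx] at this

lemma headSum_combination (f g : Fin k → ℝ) (a b : ℝ) (c : ℕ) :
    D.headSum (fun x => a * f x - b * g x) c = a * D.headSum f c - b * D.headSum g c := by
  unfold headSum
  rw [Finset.mul_sum, Finset.mul_sum, ← Finset.sum_sub_distrib]
  refine Finset.sum_congr rfl fun x _ => ?_
  split_ifs <;> simp

lemma head_to_tail_pos (hs : D.SignRules α β γ δ ε) {x z : Fin k} (h : D.head x = D.tail z) :
    0 < (-1 : ℝ) ^ D.below x * (β z * γ x - α z * δ x) := by
  obtain ⟨hα, -, hγ, -, -, -, -, hr⟩ := hs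
  have h1 := hr z x h
  have h2 := hγ x
  have hb : ((-1 : ℝ) ^ D.below x) ≠ 0 := by positivity
  rw [← mul_div_mul_left (δ x) (γ x) hb, div_lt_div_iff₀ h2 (hα z)] at h1
  linarith

lemma head_ratio_lt (hs : D.SignRules α β γ δ ε) {x y : Fin k} (h : D.Descendant x y)
    (hxy : D.head y = D.head x) : δ y / γ y < δ x / γ x := by
  induction hm : D.tail y - D.tail x using Nat.strong_induction_on generalizing y with
  | _ m ih =>
    obtain ⟨p, hp⟩ := exists_isParent h
    have hy2 := D.tail_add_two_le_head y
    have hp1 := hp.1.1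
    rcases (hp.2 x h).eq_or_lt with h1 | h1
    · obtain rfl := eq_of_tail_eq h1
      exact hs.2.2.2.2.2.2.1 y x hp hxy
    · have h2 := head_le_of_tail_lt h1 (by omega)
      have h3 := hp.1.2
      exact (hs.2.2.2.2.2.2.1 y p hp (by omega)).trans
        (ih _ (by omega) ⟨h1, h2⟩ (by omega) rfl)

lemma same_head_pos (hs : D.SignRules α β γ δ ε) {x y : Fin k} (h : D.Descendant x y)
    (hxy : D.head y = D.head x) :
    0 < (-1 : ℝ) ^ D.below x * (δ x - δ y / γ y * γ x) := by
  have h1 := head_ratio_lt hs h hxy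
  have h2 := hs.2.2.1 x
  have hb : ((-1 : ℝ) ^ D.below x) ≠ 0 := by positivity
  rw [← mul_div_mul_left (δ x) (γ x) hb, lt_div_iff₀ h2] at h1
  linarith

/-- If the entries at `c + 1` and later vanish and the contributions at `c + 1` all have weakly the
same sign, then no chord with head at `c + 1` contributes. -/
lemma coeff_eq_zero_of_head_eq (hs : D.SignRules α β γ δ ε) (c : ℕ) {e : ℝ} (he : e ≠ 0)
    (hZ : ∀ m, c ≤ m → m + 1 < n → D.entry α β γ δ ε t m = 0)
    (hκ : 0 ≤ e * (D.tailSum (fun x => D.tailCoeff ε t x * β x) c +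
      D.headSum (fun x => t x * δ x) c))
    (ht : ∀ x, D.head x = c + 1 → 0 ≤ e * ((-1) ^ D.below x * t x)) (x : Fin k)
    (hx : D.head x = c + 1) : t x = 0 := by
  have hxn := D.head_add_two_le x
  have h0 := hZ c le_rfl (by omega)
  rw [entry] at h0
  by_cases hz : ∃ z, D.tail z = c + 1
  · obtain ⟨z, hz⟩ := hz
    have hzn := D.head_add_two_le z
    have h1 := tailCoeff_mul_add_headSum_eq_zero z
      (fun m hm hm' => hZ m (by omega) (by omega)) hs.2.1
    rw [← hz, tailSum_eq, hz] at h0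
    rw [hz] at h1
    have hf : ∀ x, D.head x = c + 1 →
        0 ≤ e * β z * (t x * γ x) - e * α z * (t x * δ x) := fun x hx => by
      have := mul_nonneg_of_sign (ht x hx) (head_to_tail_pos hs (hx.trans hz.symm))
      linarith
    have := eq_zero_of_headSum_add_eq_zero hf (mul_nonneg (hs.2.1 z).le hκ) (by
      rw [headSum_combination (fun x => t x * γ x) (fun x => t x * δ x)]
      linear_combination e * β z * h0 - e * α z * h1) x hx
    exact eq_zero_of_sign he (head_to_tail_pos hs (hx.trans hz.symm)) (by linarith)
  · rw [tailSum_eq_zero (c := c + 1) fun u hu => (hz ⟨u, hu⟩).elim] at h0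
    have hf : ∀ x, D.head x = c + 1 → 0 ≤ e * (t x * γ x) - 0 * 0 := fun x hx => by
      have := mul_nonneg_of_sign (ht x hx) (hs.2.2.1 x)
      linarith
    have := eq_zero_of_headSum_add_eq_zero hf hκ (by
      rw [headSum_combination (fun x => t x * γ x) (fun _ => 0)]
      linear_combination e * h0) x hx
    exact eq_zero_of_sign he (hs.2.2.1 x) (by linarith)

/-- If the entries after `c` vanish and all partial coefficients at `c` have the expected weak
sign, then no chord with head after `c` contributes, and neither do those with head at `c`. -/
lemma coeff_eq_zero_of_openCoeff_nonneg (hs : D.SignRules α β γ δ ε) (c : ℕ)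
    (hZ : ∀ m, c ≤ m → m + 1 < n → D.entry α β γ δ ε t m = 0)
    (hd : 0 ≤ D.headSum (fun x => t x * δ x) c)
    (ho : ∀ x, D.tail x < c → c < D.head x →
      0 ≤ (-1 : ℝ) ^ D.started x c * D.openCoeff ε t x c) :
    (∀ x, c < D.head x → t x = 0) ∧ D.headSum (fun x => t x * δ x) c = 0 := by
  have hcol : ∀ z, c ≤ D.tail z →
      D.tailCoeff ε t z * β z + D.headSum (fun x => t x * δ x) (D.tail z) = 0 := fun z hz =>
    tailCoeff_mul_add_headSum_eq_zero z (fun m hm hm' => hZ m (by omega) (by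
      have := D.head_add_two_le z
      omega)) hs.2.1
  have hfirst : ∀ z, c ≤ D.tail z → t z = D.tailCoeff ε t z := fun z hz =>
    coeff_eq_tailCoeff_of_entry hs.2.1 z fun m hm hm' => hZ m (by omega) (by
      have := D.head_add_two_le z
      omega)
  have hlater : ∀ x, c < D.head x → t x = 0 := by
    intro x hx
    induction hm : D.head x using Nat.strong_induction_on generalizing x with
    | _ c' ih =>
      have ih : ∀ y, c < D.head y → D.head y < c' → t y = 0 := fun y hy hy' =>
        ih _ hy' y hy rfl
      subst hm
      obtain ⟨d, hxd⟩ : ∃ d, D.head x = d + 1 := ⟨D.head x - 1, by omega⟩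
      rw [hxd] at ih hx
      have hdn := D.head_add_two_le x
      -- chords starting between `c` and `d + 1` contribute nothing
      have hτ : ∀ z, c < D.tail z → D.tail z < d + 1 → D.tailCoeff ε t z = 0 := fun z hz hz' => by
        have := hcol z hz.le
        rw [headSum_eq_zero fun y hy => by rw [ih y (by omega) (by omega), zero_mul]] at this
        exact (mul_eq_zero.1 (by simpa using this)).resolve_right (hs.2.1 z).ne'
      have hsq := neg_one_pow_sq (D.startedIn c (d + 1))
      refine coeff_eq_zero_of_head_eq (t := t) hs d (e := (-1) ^ D.startedIn c (d + 1))
        (by positivity) (fun m hm hm' => hZ m (by omega) hm') ?_ ?_ x hxd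
      · by_cases hz : ∃ z, D.tail z = d
        · obtain ⟨z, rfl⟩ := hz
          rw [tailSum_eq, hcol z (by omega), mul_zero]
        · rw [tailSum_eq_zero fun u hu => (hz ⟨u, hu⟩).elim, zero_add]
          rcases (Nat.lt_succ_iff.1 hx).eq_or_lt with rfl | hcd
          · rw [startedIn_eq_zero fun u hu => hz ⟨u, hu⟩]
            simpa using hd
          · rw [headSum_eq_zero fun y hy => by rw [ih y (by omega) (by omega), zero_mul], mul_zero]
      · intro y hy
        rw [← started_eq_below hy.le]
        induction hm : n - D.tail y using Nat.strong_induction_on generalizing y with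
        | _ m ih' =>
          have hy2 := D.tail_add_two_le_head y
          rcases lt_trichotomy c (D.tail y) with hyc | hyc | hyc
          · rw [hfirst y hyc.le, hτ y hyc (by omega)]
            simp
          · subst hyc
            rw [startedIn_tail (by omega) hy.ge, pow_add, ← mul_assoc, mul_assoc _ _ ((-1) ^ _),
              neg_one_pow_sq, hfirst y le_rfl]
            have := hcol y le_rfl
            have : D.tailCoeff ε t y * β y ≤ 0 := by linarith
            have := nonpos_of_mul_nonpos_left this (hs.2.1 y)
            linarith
          · rw [coeff_eq_openCoeff_sub (D := D) (ε := ε) (t := t) y c]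
            have h1 := ho y hyc (by omega)
            have h2 : (-1 : ℝ) ^ D.startedIn c (d + 1) * ((-1) ^ D.started y (d + 1) *
                D.openCoeff ε t y c) = (-1) ^ D.started y c * D.openCoeff ε t y c := by
              rw [started_eq_add_startedIn hyc hx.le hy.ge, pow_add]
              linear_combination ((-1) ^ D.started y c * D.openCoeff ε t y c) * hsq
            have h3 := child_sum_nonneg (t := t) hs y (d + 1) ((-1) ^ D.startedIn c (d + 1))
              (fun u => c < D.head u) (fun u hu huc htu => by
                have hu1 := hu.1.1
                have hu2 := hu.1.2
                have hu3 := D.tail_add_two_le_head u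
                have hu4 : D.head u = d + 1 := by
                  by_contra hne
                  exact htu (ih u huc (by omega))
                exact ⟨by omega, hu4.ge, ih' _ (by omega) u hu4 rfl⟩)
            linarith
  refine ⟨hlater, ?_⟩
  by_cases hz : ∃ z, D.tail z = c
  · obtain ⟨z, rfl⟩ := hz
    have h1 := hcol z le_rfl
    have h2 := D.tail_add_two_le_head z
    rw [← hfirst z le_rfl, hlater z (by omega)] at h1
    linarith
  · by_cases hx : ∃ x, D.head x = c
    · obtain ⟨x, hx⟩ := hx
      have hxn := D.head_add_two_le x
      have h0 := hZ c le_rfl (by omega)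
      have hl : ∀ w : Fin k → ℝ, D.headSum (fun x => t x * w x) (c + 1) = 0 := fun w =>
        headSum_eq_zero fun x hx => by rw [hlater x (by omega), zero_mul]
      rw [entry, tailSum_eq_zero (c := c) fun u hu => (hz ⟨u, hu⟩).elim, hl,
        tailSum_eq_zero (c := c + 1)] at h0
      · linarith
      · intro u hu
        have h2 := D.tail_add_two_le_head u
        rw [← hfirst u (by omega), hlater u (by omega), zero_mul]
    · exact headSum_eq_zero fun x hx' => (hx ⟨x, hx'⟩).elim

/-! ### Scaling -/

lemma tailCoeff_mul (e : ℝ) (x : Fin k) :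
    D.tailCoeff ε (fun y => e * t y) x = e * D.tailCoeff ε t x := by
  rw [tailCoeff, tailCoeff, mul_add, Finset.mul_sum]
  congr 1
  refine Finset.sum_congr rfl fun y _ => ?_
  split_ifs <;> ring

lemma openCoeff_mul (e : ℝ) (x : Fin k) (c : ℕ) :
    D.openCoeff ε (fun y => e * t y) x c = e * D.openCoeff ε t x c := by
  rw [openCoeff, openCoeff, mul_sub, Finset.mul_sum, tailCoeff_mul]
  congr 1
  refine Finset.sum_congr rfl fun y _ => ?_
  split_ifs <;> ring

lemma headSum_mul (e : ℝ) (w : Fin k → ℝ) (c : ℕ) :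
    D.headSum (fun y => e * t y * w y) c = e * D.headSum (fun y => t y * w y) c := by
  rw [headSum, headSum, Finset.mul_sum]
  refine Finset.sum_congr rfl fun y _ => ?_
  split_ifs <;> ring

lemma tailSum_mul (e : ℝ) (w : Fin k → ℝ) (c : ℕ) :
    D.tailSum (fun y => D.tailCoeff ε (fun y => e * t y) y * w y) c =
      e * D.tailSum (fun y => D.tailCoeff ε t y * w y) c := by
  rw [tailSum, tailSum, Finset.mul_sum]
  refine Finset.sum_congr rfl fun y _ => ?_
  rw [tailCoeff_mul]
  split_ifs <;> ring

lemma entry_mul (e : ℝ) (c : ℕ) :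
    D.entry α β γ δ ε (fun y => e * t y) c = e * D.entry α β γ δ ε t c := by
  simp only [entry, tailSum_mul, headSum_mul]
  ring

/-- A chord starting at `J` cannot have a tail coefficient with the wrong sign. -/
lemma tailCoeff_nonpos_of_tail_eq (hs : D.SignRules α β γ δ ε) {J : ℕ}
    (hZ : ∀ m, J + 1 ≤ m → m + 1 < n → D.entry α β γ δ ε t m = 0)
    (ho : ∀ x, D.tail x < J → J ≤ D.head x →
      0 ≤ (-1 : ℝ) ^ D.started x J * D.openCoeff ε t x (J + 1))
    (ho' : ∀ x x', D.tail x < D.tail x' → D.tail x' < J → J + 1 < D.head x → J + 1 < D.head x' →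
      D.openCoeff ε t x (J + 1) = 0)
    {y : Fin k} (hyJ : D.tail y = J) : D.tailCoeff ε t y ≤ 0 := by
  subst hyJ
  by_contra! hpos
  have hy2 := D.tail_add_two_le_head y
  have hyn := D.head_add_two_le y
  obtain ⟨d, hyd⟩ : ∃ d, D.head y = d + 1 := ⟨D.head y - 1, by omega⟩
  have hyt : t y = D.tailCoeff ε t y := coeff_eq_tailCoeff_of_entry hs.2.1 y fun m hm hm' =>
    hZ m hm (by omega)
  have hin : ∀ u, D.Descendant y u → t u = 0 := coeff_descendant_eq_zero hs.2.1 y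
    fun m hm hm' => hZ m hm (by omega)
  have hin' : ∀ u, D.tail y < D.tail u → D.head u = d + 1 → t u = 0 := fun u hu hu' =>
    hin u ⟨hu, by omega⟩
  have hmid : ∀ u, D.tail y < D.head u → D.head u < d + 1 → t u = 0 := fun u hu hu' => by
    rcases lt_trichotomy (D.tail u) (D.tail y) with h | h | h
    · have := head_le_of_tail_lt h hu
      omega
    · rw [eq_of_tail_eq h] at hu'
      omega
    · exact hin u ⟨h, by omega⟩
  have hκ : D.tailSum (fun x => D.tailCoeff ε t x * β x) d +
      D.headSum (fun x => t x * δ x) d = 0 := by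
    by_cases hz : ∃ z, D.tail z = d
    · obtain ⟨z, rfl⟩ := hz
      have hzn := D.head_add_two_le z
      rw [tailSum_eq]
      exact tailCoeff_mul_add_headSum_eq_zero z
        (fun m hm hm' => hZ m (by omega) (by omega)) hs.2.1
    · rw [tailSum_eq_zero fun u hu => (hz ⟨u, hu⟩).elim, headSum_eq_zero, add_zero]
      intro x hx
      rw [hmid x (by omega) (by omega), zero_mul]
  set e : ℝ := (-1) ^ (1 + D.below y) with he
  have he0 : e ≠ 0 := by positivity
  have hee : e * e = 1 := neg_one_pow_sq _
  have hdesc : ∀ x, D.tail x < D.tail y → d + 1 ≤ D.head x → D.Descendant x y := fun x hx hx' =>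
    ⟨hx, by omega⟩
  have hstart : ∀ x, D.tail x < D.tail y → d + 1 ≤ D.head x →
      e * (-1) ^ D.started x (d + 1) = (-1) ^ D.started x (D.tail y) := fun x hx hx' => by
    rw [started_eq_add_one_add (hdesc x hx hx') (by omega) hyd.ge, started_eq_below hyd.le, add_assoc,
      pow_add]
    linear_combination (-1) ^ D.started x (D.tail y) * hee
  have hey : e * ((-1) ^ D.started y (d + 1) * t y) < 0 := by
    rw [started_eq_below hyd.le, he, pow_add, hyt]
    have := neg_one_pow_sq (D.below y)
    linear_combination hpos - this * D.tailCoeff ε t y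
  have hexp : ∀ x, D.tail x < D.tail y → D.head x = d + 1 →
      e * ((-1) ^ D.started x (d + 1) * t x) =
        (-1) ^ D.started x (D.tail y) * D.openCoeff ε t x (D.tail y + 1) -
        e * ((-1) ^ D.started x (d + 1) *
          ∑ u, if D.IsParent x u ∧ D.tail y + 1 < D.head u then ε u * t u else 0) :=
    fun x hx hx' => by
      rw [← hstart x hx hx'.ge]
      conv_lhs => rw [coeff_eq_openCoeff_sub (D := D) (ε := ε) (t := t) x (D.tail y + 1)]
      ring
  by_cases hx₁ : ∃ x₁, D.IsParent x₁ y ∧ D.head x₁ = d + 1 ∧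
      0 ≤ e * ((-1) ^ D.started x₁ (d + 1) * t x₁)
  · obtain ⟨x₁, hp₁, hd₁, hs₁⟩ := hx₁
    have hsign : ∀ x, D.head x = d + 1 → x ≠ y →
        0 ≤ e * ((-1) ^ D.started x (d + 1) * t x) := by
      intro x hx hxy
      induction hm : n - D.tail x using Nat.strong_induction_on generalizing x with
      | _ m ih =>
        have hx2 := D.tail_add_two_le_head x
        rcases lt_trichotomy (D.tail x) (D.tail y) with h | h | h
        · by_cases hxx : x = x₁
          · rwa [hxx]
          · rw [hexp x h hx]
            have h1 := ho x h (by omega)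
            have h2 := child_sum_nonneg (t := t) hs x (d + 1) e
              (fun u => D.tail y + 1 < D.head u) (fun u hu huc htu => by
                have hu1 := hu.1.1
                have hu2 := hu.1.2
                have hu3 := D.tail_add_two_le_head u
                have hu4 : D.head u = d + 1 := by
                  by_contra hne
                  exact htu (hmid u (by omega) (by omega))
                exact ⟨by omega, hu4.ge, ih _ (by omega) u hu4
                  (fun h => hxx ((h ▸ hu : D.IsParent x y).unique hp₁)) rfl⟩)
            linarith
        · exact (hxy (eq_of_tail_eq h)).elim
        · rw [hin' x h hx]
          simp
    have hf : ∀ x, D.head x = d + 1 →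
        0 ≤ e * (t x * δ x) - e * (δ y / γ y) * (t x * γ x) := fun x hx => by
      by_cases hxy : x = y
      · subst hxy
        have : γ x ≠ 0 := by
          intro h
          have := hs.2.2.1 x
          simp [h] at this
        have : e * (t x * δ x) - e * (δ x / γ x) * (t x * γ x) = 0 := by
          field_simp
          ring
        rw [this]
      · rcases lt_or_ge (D.tail x) (D.tail y) with h | h
        · have := mul_nonneg_of_sign (b := D.below x)
            (by rw [← started_eq_below hx.le]; exact hsign x hx hxy)
            (same_head_pos hs (hdesc x h hx.ge) (hyd.trans hx.symm))
          linarith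
        · rw [hin' x (h.lt_of_ne fun h => hxy (eq_of_tail_eq h).symm) hx]
          simp
    have hfsum := headSum_combination (D := D) (fun x => t x * δ x) (fun x => t x * γ x) e
      (e * (δ y / γ y)) (d + 1)
    have hfnn : 0 ≤ D.headSum (fun x => e * (t x * δ x) - e * (δ y / γ y) * (t x * γ x)) (d + 1) :=
      Finset.sum_nonneg fun x _ => by
        split_ifs with hx
        exacts [hf x hx, le_rfl]
    have h0 := hZ d (by omega) (by omega)
    rw [entry] at h0
    obtain ⟨hδ, hγ⟩ : 0 ≤ e * D.headSum (fun x => t x * δ x) (d + 1) ∧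
        (D.headSum (fun x => t x * δ x) (d + 1) = 0 →
          D.headSum (fun x => t x * γ x) (d + 1) = 0) := by
      by_cases hz : ∃ z, D.tail z = d + 1
      · obtain ⟨z, hz⟩ := hz
        have hzn := D.head_add_two_le z
        have h1 := tailCoeff_mul_add_headSum_eq_zero z
          (fun m hm hm' => hZ m (by omega) (by omega)) hs.2.1
        rw [← hz, tailSum_eq, hz] at h0
        rw [hz] at h1
        have hβ := hs.2.1 z
        have hprop : β z * D.headSum (fun x => t x * γ x) (d + 1) =
            α z * D.headSum (fun x => t x * δ x) (d + 1) := by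
          linear_combination β z * h0 - α z * h1 - β z * hκ
        constructor
        · have hr := hs.2.2.2.2.2.2.2 z y (hyd.trans hz.symm)
          rw [lt_div_iff₀ (hs.1 z)] at hr
          have : 0 ≤ (e * D.headSum (fun x => t x * δ x) (d + 1)) * (β z - δ y / γ y * α z) := by
            have := mul_nonneg hβ.le hfnn
            rw [hfsum] at this
            linear_combination this - e * (δ y / γ y) * hprop
          exact nonneg_of_mul_nonneg_left this (by linarith)
        · intro h
          rw [h, mul_zero] at hprop
          exact (mul_eq_zero.1 hprop).resolve_left hβ.ne'
      · rw [tailSum_eq_zero (c := d + 1) fun u hu => (hz ⟨u, hu⟩).elim] at h0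
        have hG : D.headSum (fun x => t x * γ x) (d + 1) = 0 := by linarith
        rw [hfsum, hG] at hfnn
        exact ⟨by linarith, fun _ => hG⟩
    have hfin := (coeff_eq_zero_of_openCoeff_nonneg (t := fun x => e * t x) hs (d + 1)
      (fun m hm hm' => by rw [entry_mul, hZ m (by omega) hm', mul_zero])
      (by rwa [headSum_mul]) (fun u hu hu' => by
        have hut : D.tail u < D.tail y := by
          by_contra hc
          rcases (not_lt.1 hc).eq_or_lt with h | h
          · rw [← eq_of_tail_eq h] at hu'
            omega
          · have := head_le_of_tail_lt h (by omega)
            omega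
        rw [openCoeff_mul, openCoeff_eq_openCoeff_sub u (c := D.tail y + 1) (by omega)]
        have h1 := ho u hut (by omega)
        rw [← hstart u hut hu'.le] at h1
        have h2 := child_sum_nonneg (t := t) hs u (d + 1) e
          (fun v => D.tail y + 1 < D.head v ∧ D.head v ≤ d + 1) (fun v hv hvc htv => by
            have hv3 := D.tail_add_two_le_head v
            have hv4 : D.head v = d + 1 := by
              by_contra hne
              exact htv (hmid v (by omega) (by omega))
            refine ⟨by omega, hv4.ge, hsign v hv4 ?_⟩
            rintro rfl
            rw [hv.unique hp₁] at hu'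
            omega)
        linarith)).2
    rw [headSum_mul] at hfin
    have hδ0 := (mul_eq_zero.1 hfin).resolve_left he0
    have hγ0 := hγ hδ0
    have hzero := eq_zero_of_headSum_add_eq_zero hf le_rfl (by rw [hfsum, hδ0, hγ0]; simp)
    have hothers : ∀ x, D.head x = d + 1 → x ≠ y → t x = 0 := fun x hx hxy => by
      rcases lt_or_ge (D.tail x) (D.tail y) with h | h
      · have := hzero x hx
        exact eq_zero_of_sign he0 (same_head_pos hs (hdesc x h hx.ge) (hyd.trans hx.symm))
          (by linarith)
      · exact hin' x (h.lt_of_ne fun h => hxy (eq_of_tail_eq h).symm) hx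
    rw [headSum, Finset.sum_eq_single y, if_pos hyd] at hγ0
    · have := eq_zero_of_sign one_ne_zero (hs.2.2.1 y) (by rw [hγ0, mul_zero])
      linarith
    · intro x _ hxy
      split_ifs with hx
      · rw [hothers x hx hxy, zero_mul]
      · rfl
    · simp
  · have hsign : ∀ x, D.head x = d + 1 → e * ((-1) ^ D.started x (d + 1) * t x) ≤ 0 := by
      intro x hx
      induction hm : n - D.tail x using Nat.strong_induction_on generalizing x with
      | _ m ih =>
        have hx2 := D.tail_add_two_le_head x
        rcases lt_trichotomy (D.tail x) (D.tail y) with h | h | h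
        · by_cases hxp : D.IsParent x y
          · by_contra! hc
            exact hx₁ ⟨x, hxp, hx, hc.le⟩
          · obtain ⟨q, hq⟩ := exists_isParent (hdesc x h hx.ge)
            have hqx := hq.2 x (hdesc x h hx.ge)
            have hqx : D.tail x < D.tail q := hqx.lt_of_ne fun hc => hxp (eq_of_tail_eq hc ▸ hq)
            have hq1 := hq.1.1
            have hq2 := hq.1.2
            rw [hexp x h hx, ho' x q hqx hq1 (by omega) (by omega)]
            have h2 := child_sum_nonneg (t := t) hs x (d + 1) (-e)
              (fun u => D.tail y + 1 < D.head u) (fun u hu huc htu => by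
                have hu1 := hu.1.1
                have hu2 := hu.1.2
                have hu3 := D.tail_add_two_le_head u
                have hu4 : D.head u = d + 1 := by
                  by_contra hne
                  exact htu (hmid u (by omega) (by omega))
                have := ih _ (by omega) u hu4 rfl
                exact ⟨by omega, hu4.ge, by linarith⟩)
            linarith
        · rw [eq_of_tail_eq h]
          exact hey.le
        · rw [hin' x h hx]
          simp
    have := coeff_eq_zero_of_head_eq (t := t) hs d (e := -e) (neg_ne_zero.2 he0)
      (fun m hm hm' => hZ m (by omega) hm') (by rw [hκ, mul_zero]) (fun x hx => by
        have := hsign x hx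
        rw [started_eq_below hx.le] at this
        linarith) y hyd
    linarith


/-! ### Linear independence of the relevant rows -/

lemma started_tail_succ (x : Fin k) : D.started x (D.tail x + 1) = 0 := by
  rw [started, Finset.card_eq_zero, Finset.filter_eq_empty_iff]
  rintro u - ⟨h, h'⟩
  have := h.1
  omega

lemma coeff_eq_zero_of_head_lt {l : Fin k}
    (h : ∀ u, D.tail u < D.head l → ¬D.IsParent u l → D.tailCoeff ε t u = 0) {x : Fin k}
    (hx : D.head x < D.head l) : t x = 0 := by
  have hx' : ∀ u, D.head u ≤ D.head x → D.tailCoeff ε t u = 0 := fun u hu => by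
    have := D.tail_add_two_le_head u
    refine h u (by omega) fun hp => ?_
    have := hp.1.2
    omega
  exact coeff_eq_zero_of_tailCoeff x (hx' x le_rfl) fun y hy => hx' y hy.2

lemma openCoeff_nonneg (hs : D.SignRules α β γ δ ε) {l : Fin k}
    (h : ∀ u, D.tail u < D.head l → ¬D.IsParent u l → D.tailCoeff ε t u = 0)
    (hp : ∀ u, D.tail u < D.head l →
      0 ≤ (-1 : ℝ) ^ D.started u (D.head l) * D.tailCoeff ε t u)
    (x : Fin k) (hx : D.tail x < D.head l) (hx' : D.head l ≤ D.head x) :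
    0 ≤ (-1 : ℝ) ^ D.started x (D.head l) * D.openCoeff ε t x (D.head l + 1) := by
  induction hm : n - D.tail x using Nat.strong_induction_on generalizing x with
  | _ m ih =>
    have hxn := D.head_add_two_le x
    have h1 := hp x hx
    have h2 := child_sum_nonneg (t := t) hs x (D.head l) 1 (fun v => D.head v ≤ D.head l + 1)
      (fun v hv hvl htv => by
        have hv1 := hv.1.1
        have hv2 := D.tail_add_two_le_head v
        have hv3 : D.head l ≤ D.head v := by
          by_contra! hc
          exact htv (coeff_eq_zero_of_head_lt h hc)
        have := ih _ (by omega) v (by omega) hv3 rfl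
        rw [openCoeff_eq_coeff hvl] at this
        exact ⟨by omega, hv3, by linarith⟩)
    rw [openCoeff]
    linarith

lemma openCoeff_eq_zero {l : Fin k}
    (h : ∀ u, D.tail u < D.head l → ¬D.IsParent u l → D.tailCoeff ε t u = 0)
    {x x' : Fin k} (hxx : D.tail x < D.tail x') (hx' : D.tail x' < D.head l)
    (hl : D.head l + 1 < D.head x') : D.openCoeff ε t x (D.head l + 1) = 0 := by
  have hl' : D.Descendant x' l := by
    refine ⟨?_, by omega⟩
    by_contra! hc
    rcases hc.lt_or_eq with hc | hc
    · have := head_le_of_tail_lt hc hx'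
      omega
    · rw [eq_of_tail_eq hc] at hl
      omega
  rw [openCoeff, h x (by omega) fun hp => by
    have := hp.2 x' hl'
    omega, zero_sub, neg_eq_zero]
  refine Finset.sum_eq_zero fun y _ => ?_
  split_ifs with hy
  · obtain ⟨hxy, hyl⟩ := hy
    have key : ∀ v, D.tail y ≤ D.tail v → D.head v ≤ D.head y → D.tailCoeff ε t v = 0 := by
      intro v hv hv'
      have hv2 := D.tail_add_two_le_head v
      refine h v (by omega) fun hvl => ?_
      have h1 := hvl.2 x' hl'
      rcases lt_trichotomy (D.tail x') (D.tail y) with h2 | h2 | h2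
      · have := hxy.2 x' ⟨h2, by omega⟩
        omega
      · rw [eq_of_tail_eq h2] at hl
        omega
      · have := head_le_of_tail_lt h2 (by omega)
        omega
    rw [coeff_eq_zero_of_tailCoeff y (key y le_rfl le_rfl) fun v hv => key v hv.1.le hv.2,
      mul_zero]
  · rfl

lemma coeff_eq_zero_of_lt_head (hs : D.SignRules α β γ δ ε) {l : Fin k}
    (hZ : ∀ m, D.head l + 1 ≤ m → m + 1 < n → D.entry α β γ δ ε t m = 0)
    (h : ∀ u, D.tail u < D.head l → ¬D.IsParent u l → D.tailCoeff ε t u = 0)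
    (hp : ∀ u, D.tail u < D.head l →
      0 ≤ (-1 : ℝ) ^ D.started u (D.head l) * D.tailCoeff ε t u)
    (x : Fin k) (hx : D.head l < D.head x) : t x = 0 := by
  have ho := openCoeff_nonneg hs h hp
  by_cases hy : ∃ y, D.tail y = D.head l
  · obtain ⟨y, hy⟩ := hy
    have hy2 := D.tail_add_two_le_head y
    have hneg := tailCoeff_nonpos_of_tail_eq hs hZ ho
      (fun x x' h1 h2 _ h4 => openCoeff_eq_zero h h1 h2 h4) hy
    have nohead : ∀ x, D.head x ≠ D.head l + 1 := fun x hx => by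
      have := D.tail_add_two_le_head x
      have := head_le_of_tail_lt (D := D) (x := x) (y := y) (by omega) (by omega)
      omega
    have hfin := (coeff_eq_zero_of_openCoeff_nonneg (t := fun x => -1 * t x) hs (D.head l + 1)
      (fun m hm hm' => by rw [entry_mul, hZ m hm hm', mul_zero])
      (by rw [headSum_eq_zero fun x hx => (nohead x hx).elim])
      (fun u hu hu' => by
        rw [openCoeff_mul]
        rcases (Nat.lt_succ_iff.1 hu).eq_or_lt with hu | hu
        · obtain rfl := eq_of_tail_eq (hu.trans hy.symm)
          rw [← hu, started_tail_succ, openCoeff, Finset.sum_eq_zero]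
          · linarith
          · refine fun v _ => if_neg ?_
            rintro ⟨hv, hv'⟩
            have := hv.1.1
            have := D.tail_add_two_le_head v
            omega
        · rw [started_eq_add_one_add (y := y) ⟨by omega, head_le_of_tail_lt (by omega) (by omega)⟩
            (by omega) (by omega), hy, ← hy, started_tail_succ, hy, pow_add, pow_add]
          have := ho u hu (by omega)
          linarith)).1 x (by
        have := nohead x
        omega)
    linarith
  · have hstart : ∀ u, D.tail u < D.head l → D.head l + 1 ≤ D.head u →
        D.started u (D.head l + 1) = D.started u (D.head l) := fun u hu hu' => by
      rw [started_eq_add_startedIn hu (Nat.le_succ _) hu', startedIn_eq_zero fun z hz => hy ⟨z, hz⟩,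
        add_zero]
    have hδ : ∀ x, D.head x = D.head l + 1 → 0 ≤ t x * δ x := fun x hx => by
      have hx2 := D.tail_add_two_le_head x
      have h1 := ho x (by omega) (by omega)
      rw [openCoeff_eq_coeff hx.le, ← hstart x (by omega) hx.ge, started_eq_below hx.le] at h1
      have := mul_nonneg_of_sign (e := 1) (by linarith) (hs.2.2.2.1 x)
      linarith
    have hfin := coeff_eq_zero_of_openCoeff_nonneg hs (D.head l + 1) hZ
      (Finset.sum_nonneg fun x _ => by
        split_ifs with hx
        exacts [hδ x hx, le_rfl])
      (fun u hu hu' => by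
        have hul : D.tail u < D.head l := by
          have : D.tail u ≠ D.head l := fun hc => hy ⟨u, hc⟩
          omega
        rw [hstart u hul hu'.le]
        exact ho u hul (by omega))
    rcases (Nat.succ_le_of_lt hx).eq_or_lt with hx | hx
    · have := eq_zero_of_headSum_add_eq_zero hδ le_rfl (by rw [hfin.2, add_zero]) x hx.symm
      exact eq_zero_of_sign one_ne_zero (hs.2.2.2.1 x) (by linarith)
    · exact hfin.1 x hx

lemma tailCoeff_eq_zero_of_tail_lt (hs : D.SignRules α β γ δ ε) {l : Fin k}
    (hS : ∀ a, a + 1 < n → a + 1 ≠ D.tail l → a + 1 ≠ D.tail l + 1 → a + 1 ≠ D.head l →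
      a + 1 ≠ D.head l + 1 → (∀ p, D.IsParent p l → a + 1 ≠ D.tail p ∧ a + 1 ≠ D.tail p + 1) →
      D.entry α β γ δ ε t a = 0) (u : Fin k) (hu : D.tail u < D.tail l)
    (hul : ¬D.IsParent u l) : D.tailCoeff ε t u = 0 := by
  have hl2 := D.tail_add_two_le_head l
  have hln := D.head_add_two_le l
  induction hm : D.tail u using Nat.strong_induction_on generalizing u with
  | _ m ih =>
    subst hm
    have hu2 := D.tail_add_two_le_head u
    have hhead : ∀ x, D.head x ≤ D.tail u → t x = 0 := fun x hx => by
      have key : ∀ v, D.head v ≤ D.head x → D.tailCoeff ε t v = 0 := fun v hv => by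
        have := D.tail_add_two_le_head v
        refine ih _ (by omega) v (by omega) (fun hvl => ?_) rfl
        have := hvl.1.2
        omega
      exact coeff_eq_zero_of_tailCoeff x (key x le_rfl) fun v hv => key v hv.2
    by_cases hp : ∃ p, D.IsParent p l ∧ D.tail p < D.tail u
    · obtain ⟨p, hp, hpu⟩ := hp
      have hul' : D.head u ≤ D.tail l := by
        by_contra! hc
        have := hp.2 u ⟨hu, head_le_of_tail_lt hu hc⟩
        omega
      have := tailCoeff_mul_add_headSum_eq_zero u (fun c hc hc' => hS c (by omega) (by omega)
        (by omega) (by omega) (by omega) fun q hq => by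
          rw [hq.unique hp]
          omega) hs.2.1
      rw [headSum_eq_zero fun x hx => by rw [hhead x hx.le, zero_mul], add_zero] at this
      exact (mul_eq_zero.1 this).resolve_right (hs.2.1 u).ne'
    · have hp : ∀ p, D.IsParent p l → D.tail u < D.tail p := fun p hpl => by
        by_contra! hc
        rcases hc.lt_or_eq with hc | hc
        · exact hp ⟨p, hpl, hc⟩
        · exact hul (eq_of_tail_eq hc ▸ hpl)
      obtain ⟨c, hc⟩ : ∃ c, D.tail u = c + 1 := ⟨D.tail u - 1, by
        have := D.one_le_tail u
        omega⟩
      have h0 := hS c (by omega) (by omega) (by omega) (by omega) (by omega) fun p hpl => by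
        have := hp p hpl
        omega
      rw [entry, ← hc, tailSum_eq, tailSum_eq_zero (c := c) fun z hz => by
          rw [ih _ (by omega) z (by omega) (fun hzl => by
            have := hp z hzl
            omega) rfl, zero_mul],
        headSum_eq_zero fun x hx => by rw [hhead x hx.le, zero_mul],
        headSum_eq_zero fun x hx => by rw [hhead x (by omega), zero_mul]] at h0
      exact (mul_eq_zero.1 (by simpa using h0)).resolve_right (hs.1 u).ne'

lemma coeff_eq_zero_of_nonneg (hs : D.SignRules α β γ δ ε) {l : Fin k}
    (hZ : ∀ m, D.head l + 1 ≤ m → m + 1 < n → D.entry α β γ δ ε t m = 0)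
    (hN : ¬D.IsTop l → ∑ x, (if D.IsTop x then t x * ε x else 0) = 0)
    (h : ∀ u, D.tail u < D.head l → ¬D.IsParent u l → D.tailCoeff ε t u = 0)
    (hp : ∀ u, D.tail u < D.head l →
      0 ≤ (-1 : ℝ) ^ D.started u (D.head l) * D.tailCoeff ε t u) : t = 0 := by
  have hlt := coeff_eq_zero_of_lt_head hs hZ h hp
  have hgt : ∀ x, D.head x < D.head l → t x = 0 := fun x hx => coeff_eq_zero_of_head_lt h hx
  suffices heq : ∀ x, D.head x = D.head l → t x = 0 by
    ext x
    rcases lt_trichotomy (D.head x) (D.head l) with hx | hx | hx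
    exacts [hgt x hx, heq x hx, hlt x hx]
  by_cases hlp : D.IsTop l
  · have h' : ∀ u, D.tail u < D.head l → D.tailCoeff ε t u = 0 := fun u hu =>
      h u hu fun hul => hlp u hul.1
    intro x hx
    have hx2 := D.tail_add_two_le_head x
    refine coeff_eq_zero_of_tailCoeff x (h' x (by omega)) fun y hy => h' y ?_
    have := D.tail_add_two_le_head y
    have := hy.2
    omega
  · intro x hx
    induction hm : D.tail x using Nat.strong_induction_on generalizing x with
    | _ m ih =>
      have hx2 := D.tail_add_two_le_head x
      by_cases hxt : D.IsTop x
      · have h0 := hN hlp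
        rw [Finset.sum_eq_single x, if_pos hxt] at h0
        · have := hs.2.2.2.2.1 x hxt
          refine (mul_eq_zero.1 h0).resolve_right ?_
          rintro h
          simp [h] at this
        · intro y _ hyx
          split_ifs with hyt
          · have hy2 := D.tail_add_two_le_head y
            rcases lt_trichotomy (D.head y) (D.head l) with hy | hy | hy
            · rw [hgt y hy, zero_mul]
            · rcases lt_trichotomy (D.tail y) (D.tail x) with hyx' | hyx' | hyx'
              · exact (hxt y ⟨hyx', by omega⟩).elim
              · exact (hyx (eq_of_tail_eq hyx')).elim
              · exact (hyt x ⟨hyx', by omega⟩).elim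
            · rw [hlt y hy, zero_mul]
          · rfl
        · simp
      · obtain ⟨u, hu⟩ : ∃ u, D.IsParent u x := by
          rw [IsTop] at hxt
          push Not at hxt
          exact exists_isParent hxt.choose_spec
        have hu1 := hu.1.1
        have hu2 := hu.1.2
        have htu : t u = 0 := by
          rcases (hx ▸ hu2 : D.head l ≤ D.head u).eq_or_lt with h1 | h1
          exacts [ih _ (by omega) u h1.symm rfl, hlt u h1]
        set f : Fin k → ℝ := fun y => if D.IsParent u y then
          ((-1) ^ D.beyond y u * ε y) * ((-1) ^ D.started y (D.head l) * t y) else 0 with hf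
        have hchild : ∀ y, D.IsParent u y → t y ≠ 0 → D.head y = D.head l := fun y _ hty => by
          by_contra hc
          rcases lt_or_gt_of_ne hc with hc | hc
          exacts [hty (hgt y hc), hty (hlt y hc)]
        have hf0 : ∀ y ∈ Finset.univ, 0 ≤ f y := fun y _ => by
          simp only [hf]
          split_ifs with hy
          · by_cases hty : t y = 0
            · simp [hty]
            · have hyl := hchild y hy hty
              have hy2 := D.tail_add_two_le_head y
              have := openCoeff_nonneg hs h hp y (by omega) hyl.ge
              rw [openCoeff_eq_coeff (by omega)] at this
              exact mul_nonneg (hs.2.2.2.2.2.1 y u hy).le this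
          · exact le_rfl
        have hsum : ∑ y, f y = -((-1) ^ D.started u (D.head l) * D.tailCoeff ε t u) := by
          rw [tailCoeff, htu, zero_add, Finset.mul_sum, ← Finset.sum_neg_distrib]
          refine Finset.sum_congr rfl fun y _ => ?_
          simp only [hf]
          split_ifs with hy
          · by_cases hty : t y = 0
            · simp [hty]
            · have hyl := hchild y hy hty
              have hy2 := D.tail_add_two_le_head y
              rw [started_mul_child hy.1 (by omega) hyl.ge, neg_neg]
          · simp
        have h0 := (Finset.sum_eq_zero_iff_of_nonneg hf0).1 (le_antisymm (by
          have := hp u (by omega)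
          linarith) (Finset.sum_nonneg hf0)) x (Finset.mem_univ x)
        simp only [hf, if_pos hu] at h0
        have := (mul_eq_zero.1 h0).resolve_left (hs.2.2.2.2.2.1 x u hu).ne'
        simpa using this

/-- A combination of the rows other than `l` that is supported on the support of row `l` is
trivial. -/
lemma coeff_eq_zero_of_support (hs : D.SignRules α β γ δ ε) {l : Fin k} (hl : t l = 0)
    (hS : ∀ a, a + 1 < n → a + 1 ≠ D.tail l → a + 1 ≠ D.tail l + 1 → a + 1 ≠ D.head l →
      a + 1 ≠ D.head l + 1 → (∀ p, D.IsParent p l → a + 1 ≠ D.tail p ∧ a + 1 ≠ D.tail p + 1) →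
      D.entry α β γ δ ε t a = 0)
    (hN : ¬D.IsTop l → ∑ x, (if D.IsTop x then t x * ε x else 0) = 0) : t = 0 := by
  have hl2 := D.tail_add_two_le_head l
  have hln := D.head_add_two_le l
  have hparent : ∀ a, D.tail l < a → ∀ p, D.IsParent p l →
      a + 1 ≠ D.tail p ∧ a + 1 ≠ D.tail p + 1 := fun a ha p hp => by
    have := hp.1.1
    omega
  have hZ : ∀ m, D.head l + 1 ≤ m → m + 1 < n → D.entry α β γ δ ε t m = 0 := fun m hm hm' =>
    hS m hm' (by omega) (by omega) (by omega) (by omega) (hparent m (by omega))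
  have hin : ∀ c, D.tail l + 1 ≤ c → c + 1 < D.head l → D.entry α β γ δ ε t c = 0 :=
    fun c hc hc' => hS c (by omega) (by omega) (by omega) (by omega) (by omega)
      (hparent c (by omega))
  have h : ∀ u, D.tail u < D.head l → ¬D.IsParent u l → D.tailCoeff ε t u = 0 := by
    intro u hu hul
    rcases lt_trichotomy (D.tail u) (D.tail l) with h1 | h1 | h1
    · exact tailCoeff_eq_zero_of_tail_lt hs hS u h1 hul
    · rw [eq_of_tail_eq h1, ← coeff_eq_tailCoeff_of_entry hs.2.1 l hin, hl]
    · exact tailCoeff_descendant_eq_zero hs.2.1 l hin u ⟨h1, head_le_of_tail_lt h1 hu⟩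
  by_cases hp : ∃ p, D.IsParent p l ∧
      (-1 : ℝ) ^ D.started p (D.head l) * D.tailCoeff ε t p < 0
  · obtain ⟨p, hpl, hp⟩ := hp
    have := coeff_eq_zero_of_nonneg (t := fun x => -1 * t x) hs (l := l)
      (fun m hm hm' => by rw [entry_mul, hZ m hm hm', mul_zero])
      (fun hlt => by
        refine Eq.trans ?_ (mul_eq_zero_of_right (-1 : ℝ) (hN hlt))
        rw [Finset.mul_sum]
        refine Finset.sum_congr rfl fun x _ => ?_
        split_ifs <;> ring)
      (fun u hu hul => by rw [tailCoeff_mul, h u hu hul, mul_zero])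
      (fun u hu => by
        rw [tailCoeff_mul]
        by_cases hul : D.IsParent u l
        · rw [hul.unique hpl]
          linarith
        · rw [h u hu hul]
          simp)
    ext x
    simpa using congrFun this x
  · push Not at hp
    refine coeff_eq_zero_of_nonneg hs hZ hN h fun u hu => ?_
    by_cases hul : D.IsParent u l
    · exact hp u hul
    · rw [h u hu hul, mul_zero]

/-! ### Rows of the domino matrix -/

lemma sum_mul_dominoMatrix (a : Fin n) :
    ∑ m, t m * D.dominoMatrix α β γ δ ε m a = D.entry α β γ δ ε t a +
      if (a : ℕ) + 1 = n then ∑ x, (if D.IsTop x then t x * ε x else 0) else 0 := by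
  have hparent : ∑ m, t m * (∑ p, if D.IsParent p m then
        (if (a : ℕ) + 1 = D.tail p then ε m * α p else 0) +
        (if (a : ℕ) + 1 = D.tail p + 1 then ε m * β p else 0) else 0) =
      ∑ p, (∑ m, if D.IsParent p m then ε m * t m else 0) *
        ((if (a : ℕ) + 1 = D.tail p then α p else 0) +
          (if (a : ℕ) + 1 = D.tail p + 1 then β p else 0)) := by
    simp_rw [Finset.mul_sum, Finset.sum_mul]
    rw [Finset.sum_comm]
    refine Finset.sum_congr rfl fun p _ => Finset.sum_congr rfl fun m _ => ?_
    split_ifs <;> ring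
  have htop : (if (a : ℕ) + 1 = n then ∑ x, (if D.IsTop x then t x * ε x else 0) else 0) =
      ∑ x, t x * (if D.IsTop x ∧ (a : ℕ) + 1 = n then ε x else 0) := by
    split_ifs with h
    · refine Finset.sum_congr rfl fun x _ => ?_
      by_cases hx : D.IsTop x <;> simp [hx, h]
    · simp [h]
  rw [htop]
  simp only [dominoMatrix, Matrix.of_apply, mul_add, Finset.sum_add_distrib, hparent]
  simp only [← Finset.sum_add_distrib, ← mul_add, entry, tailSum, headSum, tailCoeff]
  refine Finset.sum_congr rfl fun x _ => ?_
  simp only [Nat.add_right_cancel_iff, eq_comm (a := (a : ℕ) + 1)]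
  split_ifs <;> ring

lemma entry_eq_zero_of_le {a : ℕ} (h : n ≤ a + 1) : D.entry α β γ δ ε t a = 0 := by
  have hx : ∀ x, D.tail x + 2 ≤ D.head x ∧ D.head x + 2 ≤ n := fun x =>
    ⟨D.tail_add_two_le_head x, D.head_add_two_le x⟩
  rw [entry, tailSum_eq_zero, tailSum_eq_zero, headSum_eq_zero, headSum_eq_zero]
  · simp
  all_goals
    intro x hx'
    have := hx x
    omega

lemma dominoMatrix_eq_zero {l : Fin k} {a : Fin n} (h₁ : (a : ℕ) + 1 ≠ D.tail l)
    (h₂ : (a : ℕ) + 1 ≠ D.tail l + 1) (h₃ : (a : ℕ) + 1 ≠ D.head l)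
    (h₄ : (a : ℕ) + 1 ≠ D.head l + 1) (h₅ : ¬(D.IsTop l ∧ (a : ℕ) + 1 = n))
    (h₆ : ∀ p, D.IsParent p l → (a : ℕ) + 1 ≠ D.tail p ∧ (a : ℕ) + 1 ≠ D.tail p + 1) :
    D.dominoMatrix α β γ δ ε l a = 0 := by
  simp only [dominoMatrix, Matrix.of_apply, if_neg h₁, if_neg h₂, if_neg h₃, if_neg h₄, if_neg h₅,
    zero_add]
  refine Finset.sum_eq_zero fun p _ => ite_eq_right_iff.2 fun hp => ?_
  rw [if_neg (h₆ p hp).1, if_neg (h₆ p hp).2, add_zero]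

lemma dominoMatrix_tail (l : Fin k) (a : Fin n) (ha : (a : ℕ) = D.tail l) :
    D.dominoMatrix α β γ δ ε l a = β l := by
  have h1 := D.tail_add_two_le_head l
  have h2 := D.head_add_two_le l
  simp only [dominoMatrix, Matrix.of_apply, ha]
  rw [if_neg (by omega), if_pos trivial, if_neg (by omega), if_neg (by omega), if_neg (by omega),
    Finset.sum_eq_zero]
  · simp
  · refine fun p _ => ite_eq_right_iff.2 fun hp => ?_
    have := hp.1.1
    rw [if_neg (by omega), if_neg (by omega), add_zero]

lemma dominoMatrix_eq_smul (hs : D.SignRules α β γ δ ε) {α' β' γ' δ' ε' : Fin k → ℝ} (l : Fin k)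
    (h : D.dominoMatrix α' β' γ' δ' ε' l ∈ rowSpace (D.dominoMatrix α β γ δ ε)) :
    ∃ c : ℝ, D.dominoMatrix α' β' γ' δ' ε' l = c • D.dominoMatrix α β γ δ ε l := by
  have hl2 := D.tail_add_two_le_head l
  have hln := D.head_add_two_le l
  obtain ⟨s, hs'⟩ := (Submodule.mem_span_range_iff_exists_fun ℝ).1 h
  have hrow : ∀ a, ∑ m, Function.update s l 0 m * D.dominoMatrix α β γ δ ε m a =
      D.dominoMatrix α' β' γ' δ' ε' l a - s l * D.dominoMatrix α β γ δ ε l a := fun a => by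
    rw [← hs', Finset.sum_apply, ← Finset.add_sum_erase _ _ (Finset.mem_univ l),
      ← Finset.add_sum_erase _ (fun m => (s m • D.dominoMatrix α β γ δ ε m) a) (Finset.mem_univ l)]
    simp only [Function.update_self, zero_mul, zero_add, Pi.smul_apply, smul_eq_mul,
      add_sub_cancel_left]
    refine Finset.sum_congr rfl fun m hm => ?_
    rw [Function.update_of_ne (Finset.ne_of_mem_erase hm)]
  have h0 : Function.update s l 0 = 0 := by
    refine coeff_eq_zero_of_support hs (Function.update_self ..) ?_ ?_
    · intro a ha h1 h2 h3 h4 h5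
      have := sum_mul_dominoMatrix (D := D) (α := α) (β := β) (γ := γ) (δ := δ) (ε := ε)
        (t := Function.update s l 0) ⟨a, by omega⟩
      rw [hrow, dominoMatrix_eq_zero h1 h2 h3 h4 (fun h => ha.ne h.2) h5,
        dominoMatrix_eq_zero h1 h2 h3 h4 (fun h => ha.ne h.2) h5, if_neg ha.ne] at this
      simpa using this.symm
    · intro hlt
      have hn : n - 1 + 1 = n := by omega
      have := sum_mul_dominoMatrix (D := D) (α := α) (β := β) (γ := γ) (δ := δ) (ε := ε)
        (t := Function.update s l 0) ⟨n - 1, by omega⟩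
      have hz : ∀ α β γ δ ε : Fin k → ℝ,
          D.dominoMatrix α β γ δ ε l ⟨n - 1, by omega⟩ = 0 := fun α β γ δ ε =>
        dominoMatrix_eq_zero (by simp only; omega) (by simp only; omega) (by simp only; omega)
          (by simp only; omega) (fun h => hlt h.1) fun p hp => by
            have := hp.1.1
            simp only
            omega
      rw [hrow, hz, hz, if_pos hn, entry_eq_zero_of_le hn.ge] at this
      simpa using this.symm
  refine ⟨s l, funext fun a => ?_⟩
  have := hrow a
  rw [h0] at this
  simp only [Pi.zero_apply, zero_mul, Finset.sum_const_zero] at this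
  rw [Pi.smul_apply, smul_eq_mul]
  linarith

end ChordDiagram

/-- If two domino matrices of the same chord diagram `D`, both
satisfying the sign rules, have the same row space, then they differ by rescaling each
row by a positive real number. -/
theorem domino_representative_unique_up_to_row_scaling
    (n k : ℕ) (hk : 1 ≤ k) (hn : k + 4 ≤ n)
    (D : ChordDiagram n k)
    (α β γ δ ε α' β' γ' δ' ε' : Fin k → ℝ)
    (hs : D.SignRules α β γ δ ε) (hs' : D.SignRules α' β' γ' δ' ε')
    (hspan : rowSpace (D.dominoMatrix α β γ δ ε) =
      rowSpace (D.dominoMatrix α' β' γ' δ' ε')) :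
    ∃ lam : Fin k → ℝ, (∀ l, 0 < lam l) ∧
      ∀ l, D.dominoMatrix α' β' γ' δ' ε' l = lam l • D.dominoMatrix α β γ δ ε l := by
  have hrow : ∀ l, ∃ c : ℝ, D.dominoMatrix α' β' γ' δ' ε' l = c • D.dominoMatrix α β γ δ ε l :=
    fun l => ChordDiagram.dominoMatrix_eq_smul hs l
      (hspan ▸ Submodule.subset_span (Set.mem_range_self l))
  choose lam hlam using hrow
  refine ⟨lam, fun l => ?_, hlam⟩
  have h1 := D.tail_add_two_le_head l
  have h2 := D.head_add_two_le l
  have h := congrFun (hlam l) ⟨D.tail l, by omega⟩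
  rw [Pi.smul_apply, smul_eq_mul, ChordDiagram.dominoMatrix_tail l _ rfl,
    ChordDiagram.dominoMatrix_tail l _ rfl] at h
  exact pos_of_mul_pos_left (h ▸ hs'.2.1 l) (hs.2.1 l).le

end
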